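/- arXiv:2305.09046 — 9 statements merged into one kernel-verified Lean document; each statement's English description precedes it below -/
import Mathlib

section
/- Let f : ℝ^n → ℝ be continuously differentiable, and let w : [0,∞) → ℝ^n be differentiable and satisfy the Cauchy-Simplex gradient flow dw_i/dt = −w_i(t)(∇_i f(w(t)) − w(t)·∇f(w(t))) with w(t) in the interior of the simplex (∑_i w_i(t)=1 and w_i(t)>0) for all t. Then d/dt f(w(t)) = −Var[∇f | w(t)], where Var[∇f | w] = ∑_i w_i (∇_i f(w) − w·∇f(w))² ≥ 0; in particular t ↦ f(w(t)) is nonincreasing. -/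
open Set

/-- For weights summing to one, centring one factor of a weighted second moment suffices. -/
theorem sum_weighted_mul_centred_eq_sum_weighted_centred_sq {ι : Type*} [Fintype ι]
    (p g : ι → ℝ) (hp : ∑ i, p i = 1) :
    ∑ i, p i * (g i - ∑ j, p j * g j) * g i = ∑ i, p i * (g i - ∑ j, p j * g j) ^ 2 := by
  set m := ∑ j, p j * g j with hm
  have hcentred : ∑ i, p i * (g i - m) = 0 := by
    simp_rw [mul_sub, Finset.sum_sub_distrib, ← Finset.sum_mul, hp, ← hm]
    ring
  calc ∑ i, p i * (g i - m) * g i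
      = ∑ i, (p i * (g i - m) ^ 2 + p i * (g i - m) * m) :=
        Finset.sum_congr rfl fun i _ => by ring
    _ = ∑ i, p i * (g i - m) ^ 2 := by
        rw [Finset.sum_add_distrib, ← Finset.sum_mul, hcentred, zero_mul, add_zero]

/-- Chain rule along a curve in Euclidean space with coordinatewise derivatives. -/
theorem HasGradientAt.comp_hasDerivWithinAt_coord {ι : Type*} [Fintype ι]
    {f : EuclideanSpace ℝ ι → ℝ} {w : ℝ → EuclideanSpace ℝ ι} {g v : EuclideanSpace ℝ ι}
    {s : Set ℝ} {t : ℝ} (hf : HasGradientAt f g (w t))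
    (hw : ∀ i, HasDerivWithinAt (fun r => w r i) (v i) s t) :
    HasDerivWithinAt (fun r => f (w r)) (∑ i, v i * g i) s t := by
  have hw' : HasDerivWithinAt w v s t := by
    rw [hasDerivWithinAt_iff_hasFDerivWithinAt, hasFDerivWithinAt_euclidean]
    intro i
    have hcoord : PiLp.proj 2 (fun _ : ι => ℝ) i ∘L ContinuousLinearMap.toSpanSingleton ℝ v =
        ContinuousLinearMap.toSpanSingleton ℝ (v i) := by
      ext
      simp
    exact hcoord ▸ (hw i).hasFDerivWithinAt
  have hinner : InnerProductSpace.toDual ℝ _ g v = ∑ i, v i * g i := by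
    simp [PiLp.inner_apply]
  exact hinner ▸ hf.hasFDerivAt.comp_hasDerivWithinAt t hw'

/-- Along the Cauchy-Simplex gradient flow `dw_i/dt = -w_i (∇_i f - w·∇f)` staying in the
interior of the probability simplex, the objective satisfies
`d/dt f(w(t)) = -Var[∇f | w(t)] ≤ 0`; in particular `t ↦ f(w(t))` is nonincreasing. -/
theorem cauchy_simplex_flow_objective_decreasing {n : ℕ}
    (f : EuclideanSpace ℝ (Fin n) → ℝ) (hf : ContDiff ℝ 1 f)
    (w : ℝ → EuclideanSpace ℝ (Fin n))
    (hflow : ∀ t ∈ Ici (0 : ℝ), ∀ i,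
      HasDerivWithinAt (fun s => w s i)
        (-(w t i * (gradient f (w t) i - ∑ j, w t j * gradient f (w t) j))) (Ici 0) t)
    (hsum : ∀ t ∈ Ici (0 : ℝ), ∑ i, w t i = 1)
    (hpos : ∀ t ∈ Ici (0 : ℝ), ∀ i, 0 < w t i) :
    (∀ t ∈ Ici (0 : ℝ),
      HasDerivWithinAt (fun s => f (w s))
        (-(∑ i, w t i * (gradient f (w t) i - ∑ j, w t j * gradient f (w t) j) ^ 2))
        (Ici 0) t
      ∧ 0 ≤ ∑ i, w t i * (gradient f (w t) i - ∑ j, w t j * gradient f (w t) j) ^ 2)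
    ∧ AntitoneOn (fun t => f (w t)) (Ici 0) := by
  have hnonneg : ∀ t ∈ Ici (0 : ℝ),
      0 ≤ ∑ i, w t i * (gradient f (w t) i - ∑ j, w t j * gradient f (w t) j) ^ 2 :=
    fun t ht => Finset.sum_nonneg fun i _ => mul_nonneg (hpos t ht i).le (sq_nonneg _)
  have hderiv : ∀ t ∈ Ici (0 : ℝ), HasDerivWithinAt (fun s => f (w s))
      (-(∑ i, w t i * (gradient f (w t) i - ∑ j, w t j * gradient f (w t) j) ^ 2))
      (Ici 0) t := by
    intro t ht
    have hgrad := ((hf.differentiable one_ne_zero) (w t)).hasGradientAt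
    have h := hgrad.comp_hasDerivWithinAt_coord
      (v := WithLp.toLp 2 fun i =>
        -(w t i * (gradient f (w t) i - ∑ j, w t j * gradient f (w t) j)))
      (hflow t ht)
    convert h using 1
    rw [← sum_weighted_mul_centred_eq_sum_weighted_centred_sq _ _ (hsum t ht),
      ← Finset.sum_neg_distrib]
    exact Finset.sum_congr rfl fun i _ => (neg_mul _ _).symm
  refine ⟨fun t ht => ⟨hderiv t ht, hnonneg t ht⟩, ?_⟩
  exact antitoneOn_of_hasDerivWithinAt_nonpos (convex_Ici 0)
    (fun t ht => (hderiv t ht).continuousWithinAt)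
    (fun t ht => (hderiv t (interior_subset ht)).mono interior_subset)
    (fun t ht => neg_nonpos.2 (hnonneg t (interior_subset ht)))
end

section
/- Let f : ℝ^n → ℝ be convex and continuously differentiable, let w* ∈ Δ^n be a minimizer of f over the probability simplex Δ^n, and let w : [0,∞) → ℝ^n be a differentiable solution of the Cauchy-Simplex gradient flow dw_i/dt = −w_i(t)(∇_i f(w(t)) − w(t)·∇f(w(t))) with w(t) in the interior of Δ^n for all t. Then the relative entropy t ↦ D(w* | w(t)) satisfies d/dt D(w* | w(t)) = ∇f(w(t))·(w* − w(t)) ≤ f(w*) − f(w(t)) ≤ 0; in particular it is nonincreasing in t. -/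
open Set

/-- First-order characterization of convexity: a convex function lies above its tangent planes. -/
theorem ConvexOn.add_inner_gradient_le {E : Type*} [NormedAddCommGroup E]
    [InnerProductSpace ℝ E] [CompleteSpace E] {f : E → ℝ} (hf : ConvexOn ℝ univ f) {x : E}
    (hfx : DifferentiableAt ℝ f x) (y : E) :
    f x + inner ℝ (gradient f x) (y - x) ≤ f y := by
  have hconv : ConvexOn ℝ univ (f ∘ AffineMap.lineMap (k := ℝ) x y) :=
    hf.comp_affineMap (AffineMap.lineMap x y)
  have hderiv : HasDerivAt (f ∘ AffineMap.lineMap (k := ℝ) x y)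
      (inner ℝ (gradient f x) (y - x)) 0 := by
    have hgrad : HasFDerivAt f (InnerProductSpace.toDual ℝ E (gradient f x))
        (AffineMap.lineMap (k := ℝ) x y 0) := by
      simpa using hfx.hasGradientAt.hasFDerivAt
    simpa using hgrad.comp_hasDerivAt (0 : ℝ) AffineMap.hasDerivAt_lineMap
  have hslope := hconv.le_slope_of_hasDerivAt (mem_univ 0) (mem_univ 1) one_pos hderiv
  simp only [slope_def_field, Function.comp_apply, AffineMap.lineMap_apply_zero,
    AffineMap.lineMap_apply_one, sub_zero, div_one] at hslope
  linarith

/-- Logarithmic derivative of a summand of the relative entropy. -/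
theorem HasDerivWithinAt.relEntropy_summand {u : ℝ} {w : ℝ → ℝ} {c : ℝ} {s : Set ℝ} {t : ℝ}
    (hw : HasDerivWithinAt w (-(w t * c)) s t) (ht : w t ≠ 0) :
    HasDerivWithinAt (fun r => if u = 0 then (0 : ℝ) else u * Real.log (u / w r)) (u * c) s t := by
  by_cases hu : u = 0
  · simpa [hu] using hasDerivWithinAt_const t s (0 : ℝ)
  · simp only [if_neg hu]
    have hdiv := (hasDerivWithinAt_const t s u).fun_div hw ht
    refine ((hdiv.log (div_ne_zero hu ht)).const_mul u).congr_deriv ?_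
    field_simp
    ring

/-- Along the Cauchy-Simplex gradient flow staying in the interior of the simplex, the
relative entropy `D(w* | w(t))` to a minimizer `w*` of the convex objective `f` satisfies
`d/dt D(w* | w(t)) = ∇f(w(t))·(w* - w(t)) ≤ f(w*) - f(w(t)) ≤ 0`, and is nonincreasing. -/
theorem cauchy_simplex_flow_relative_entropy_decreasing {n : ℕ}
    (f : EuclideanSpace ℝ (Fin n) → ℝ) (hfconv : ConvexOn ℝ univ f) (hf : ContDiff ℝ 1 f)
    (wstar : EuclideanSpace ℝ (Fin n))
    (hstar_pos : ∀ i, 0 ≤ wstar i) (hstar_sum : ∑ i, wstar i = 1)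
    (hstar_min : ∀ v : EuclideanSpace ℝ (Fin n),
      (∀ i, 0 ≤ v i) → ∑ i, v i = 1 → f wstar ≤ f v)
    (w : ℝ → EuclideanSpace ℝ (Fin n))
    (hflow : ∀ t ∈ Ici (0 : ℝ), ∀ i,
      HasDerivWithinAt (fun s => w s i)
        (-(w t i * (gradient f (w t) i - ∑ j, w t j * gradient f (w t) j))) (Ici 0) t)
    (hsum : ∀ t ∈ Ici (0 : ℝ), ∑ i, w t i = 1)
    (hpos : ∀ t ∈ Ici (0 : ℝ), ∀ i, 0 < w t i) :
    (∀ t ∈ Ici (0 : ℝ),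
      HasDerivWithinAt
        (fun s => ∑ i, if wstar i = 0 then (0 : ℝ) else wstar i * Real.log (wstar i / w s i))
        (∑ i, gradient f (w t) i * (wstar i - w t i)) (Ici 0) t
      ∧ (∑ i, gradient f (w t) i * (wstar i - w t i)) ≤ f wstar - f (w t)
      ∧ f wstar - f (w t) ≤ 0)
    ∧ AntitoneOn
        (fun t => ∑ i, if wstar i = 0 then (0 : ℝ) else wstar i * Real.log (wstar i / w t i))
        (Ici 0) := by
  have hmain : ∀ t ∈ Ici (0 : ℝ),
      HasDerivWithinAt
        (fun s => ∑ i, if wstar i = 0 then (0 : ℝ) else wstar i * Real.log (wstar i / w s i))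
        (∑ i, gradient f (w t) i * (wstar i - w t i)) (Ici 0) t
      ∧ (∑ i, gradient f (w t) i * (wstar i - w t i)) ≤ f wstar - f (w t)
      ∧ f wstar - f (w t) ≤ 0 := by
    intro t ht
    refine ⟨?_, ?_, ?_⟩
    · refine (HasDerivWithinAt.fun_sum (u := Finset.univ) fun i _ =>
        (hflow t ht i).relEntropy_summand (u := wstar i) (hpos t ht i).ne').congr_deriv ?_
      simp only [mul_sub, Finset.sum_sub_distrib, ← Finset.sum_mul, hstar_sum, one_mul]
      simp only [mul_comm]
    · have hgrad := hfconv.add_inner_gradient_le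
        ((hf.differentiable one_ne_zero).differentiableAt (x := w t)) wstar
      simp only [PiLp.inner_apply, RCLike.inner_apply, conj_trivial, PiLp.sub_apply,
        mul_comm (wstar _ - w t _)] at hgrad
      linarith
    · exact sub_nonpos.mpr (hstar_min _ (fun i => (hpos t ht i).le) (hsum t ht))
  refine ⟨hmain, ?_⟩
  refine antitoneOn_of_hasDerivWithinAt_nonpos (convex_Ici 0)
    (fun t ht => (hmain t ht).1.continuousWithinAt)
    (fun t ht => (hmain t (interior_subset ht)).1.mono interior_subset) fun t ht => ?_
  obtain ⟨-, hle, hnonpos⟩ := hmain t (interior_subset ht)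
  exact hle.trans hnonpos
end

section
/- Let f : ℝ^n → ℝ be convex and continuously differentiable, let w* ∈ Δ^n be a minimizer of f over Δ^n, and let w : [0,∞) → ℝ^n be a differentiable solution of the Cauchy-Simplex gradient flow dw_i/dt = −w_i(t)(∇_i f(w(t)) − w(t)·∇f(w(t))) remaining in the interior of Δ^n, with initial condition w(0) = (1/n, …, 1/n). Then for every T > 0, f(w(T)) − f(w*) ≤ log(n)/T. -/
open Set

/-- First-order characterisation of convexity: a convex function lies above its tangents. -/
theorem ConvexOn.fderiv_sub_le {E : Type*} [NormedAddCommGroup E] [NormedSpace ℝ E] {f : E → ℝ}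
    (hf : ConvexOn ℝ univ f) {x : E} (hx : DifferentiableAt ℝ f x) (y : E) :
    fderiv ℝ f x (y - x) ≤ f y - f x := by
  have hconv : ConvexOn ℝ univ (f ∘ AffineMap.lineMap (k := ℝ) x y) :=
    hf.comp_affineMap (AffineMap.lineMap x y)
  have hderiv : HasDerivAt (f ∘ AffineMap.lineMap (k := ℝ) x y) (fderiv ℝ f x (y - x)) 0 := by
    refine HasFDerivAt.comp_hasDerivAt 0 ?_ AffineMap.hasDerivAt_lineMap
    simpa using hx.hasFDerivAt
  simpa [slope_def_field] using
    hconv.le_slope_of_hasDerivAt (mem_univ 0) (mem_univ 1) one_pos hderiv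

/-- Chain rule in coordinates along a curve in Euclidean space. -/
theorem HasDerivWithinAt.comp_euclideanSpace {ι : Type*} [Fintype ι]
    {f : EuclideanSpace ℝ ι → ℝ} {w : ℝ → EuclideanSpace ℝ ι} {w' : ι → ℝ} {s : Set ℝ} {t : ℝ}
    (hf : DifferentiableAt ℝ f (w t))
    (hw : ∀ i, HasDerivWithinAt (fun r => w r i) (w' i) s t) :
    HasDerivWithinAt (fun r => f (w r)) (∑ i, gradient f (w t) i * w' i) s t := by
  have hcurve : HasDerivWithinAt w (WithLp.toLp 2 w') s t := by
    rw [hasDerivWithinAt_iff_hasFDerivWithinAt, hasFDerivWithinAt_euclidean]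
    intro i
    refine (hw i).hasFDerivWithinAt.congr_fderiv ?_
    ext
    simp
  refine (hf.hasFDerivAt.comp_hasDerivWithinAt t hcurve).congr_deriv ?_
  rw [← inner_gradient_left, PiLp.inner_apply]
  simp [mul_comm]

/-- The variance of `g` under the weights `w`, written as a covariance, is nonnegative. -/
theorem sum_mul_mul_sub_weighted_mean_nonneg {ι : Type*} [Fintype ι] {w : ι → ℝ}
    (hw : ∀ i, 0 ≤ w i) (hsum : ∑ i, w i = 1) (g : ι → ℝ) :
    0 ≤ ∑ i, g i * (w i * (g i - ∑ j, w j * g j)) := by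
  set m := ∑ j, w j * g j with hm
  have hvar : ∑ i, g i * (w i * (g i - m)) = ∑ i, w i * (g i - m) ^ 2 := by
    have hcentred : ∑ i, w i * (g i - m) = 0 := by
      simp [mul_sub, ← hm, ← Finset.sum_mul, hsum]
    rw [← sub_eq_zero, ← Finset.sum_sub_distrib]
    calc ∑ i, (g i * (w i * (g i - m)) - w i * (g i - m) ^ 2)
        = m * ∑ i, w i * (g i - m) := by
          rw [Finset.mul_sum]
          exact Finset.sum_congr rfl fun i _ => by ring
      _ = 0 := by rw [hcentred, mul_zero]
  rw [hvar]
  exact Finset.sum_nonneg fun i _ => mul_nonneg (hw i) (sq_nonneg _)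

/-- O(1/T) convergence of the Cauchy-Simplex gradient flow: starting from the uniform
vector `w(0) = (1/n, …, 1/n)` and staying in the interior of the simplex,
`f(w(T)) - f(w*) ≤ log n / T` for every `T > 0`. -/
theorem cauchy_simplex_flow_convergence_rate {n : ℕ} (hn : 0 < n)
    (f : EuclideanSpace ℝ (Fin n) → ℝ) (hfconv : ConvexOn ℝ univ f) (hf : ContDiff ℝ 1 f)
    (wstar : EuclideanSpace ℝ (Fin n))
    (hstar_pos : ∀ i, 0 ≤ wstar i) (hstar_sum : ∑ i, wstar i = 1)
    (hstar_min : ∀ v : EuclideanSpace ℝ (Fin n),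
      (∀ i, 0 ≤ v i) → ∑ i, v i = 1 → f wstar ≤ f v)
    (w : ℝ → EuclideanSpace ℝ (Fin n))
    (hflow : ∀ t ∈ Ici (0 : ℝ), ∀ i,
      HasDerivWithinAt (fun s => w s i)
        (-(w t i * (gradient f (w t) i - ∑ j, w t j * gradient f (w t) j))) (Ici 0) t)
    (hsum : ∀ t ∈ Ici (0 : ℝ), ∑ i, w t i = 1)
    (hpos : ∀ t ∈ Ici (0 : ℝ), ∀ i, 0 < w t i)
    (hw0 : ∀ i, w 0 i = 1 / n) :
    ∀ T : ℝ, 0 < T → f (w T) - f wstar ≤ Real.log n / T := by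
  intro T hT
  have hdiff : Differentiable ℝ f := hf.differentiable one_ne_zero
  set V : ℝ → ℝ := fun t => t * (f (w t) - f wstar) - ∑ i, wstar i * Real.log (w t i) with hV
  set V' : ℝ → ℝ := fun t =>
    1 * (f (w t) - f wstar)
      + t * ∑ i, gradient f (w t) i *
          -(w t i * (gradient f (w t) i - ∑ j, w t j * gradient f (w t) j))
      - ∑ i, wstar i *
          (-(w t i * (gradient f (w t) i - ∑ j, w t j * gradient f (w t) j)) / w t i) with hV'
  have hderiv : ∀ t ∈ Ici (0 : ℝ), HasDerivWithinAt V (V' t) (Ici 0) t := fun t ht =>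
    ((hasDerivWithinAt_id t _).mul
      ((HasDerivWithinAt.comp_euclideanSpace (hdiff _) (hflow t ht)).sub_const _)).sub
      (HasDerivWithinAt.fun_sum fun i _ =>
        ((hflow t ht i).log (hpos t ht i).ne').const_mul (wstar i))
  have hV'_nonpos : ∀ t ∈ Ici (0 : ℝ), V' t ≤ 0 := by
    intro t ht
    have hvar := mul_nonneg (mem_Ici.1 ht) (sum_mul_mul_sub_weighted_mean_nonneg
      (fun i => (hpos t ht i).le) (hsum t ht) (fun i => gradient f (w t) i))
    have htangent := hfconv.fderiv_sub_le (hdiff (w t)) wstar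
    rw [← inner_gradient_left, PiLp.inner_apply] at htangent
    have hentropy : ∑ i, wstar i *
        (-(w t i * (gradient f (w t) i - ∑ j, w t j * gradient f (w t) j)) / w t i)
        = -∑ i, inner ℝ (gradient f (w t) i) ((wstar - w t) i) := by
      have hcancel : ∀ i, wstar i *
          (-(w t i * (gradient f (w t) i - ∑ j, w t j * gradient f (w t) j)) / w t i)
          = wstar i * (∑ j, w t j * gradient f (w t) j) - wstar i * gradient f (w t) i := by
        intro i
        have := (hpos t ht i).ne'
        field_simp
        ring
      simp only [hcancel, Finset.sum_sub_distrib, ← Finset.sum_mul, hstar_sum]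
      simp [sub_mul, Finset.sum_sub_distrib]
    simp only [hV', hentropy, mul_neg, Finset.sum_neg_distrib]
    linarith
  have hanti : AntitoneOn V (Ici 0) :=
    antitoneOn_of_hasDerivWithinAt_nonpos (convex_Ici 0)
      (fun t ht => (hderiv t ht).continuousWithinAt)
      (fun t ht => (hderiv t (interior_subset ht)).mono interior_subset)
      fun t ht => hV'_nonpos t (interior_subset ht)
  have hle : V T ≤ V 0 := hanti self_mem_Ici (mem_Ici.2 hT.le) hT.le
  have hV0 : V 0 = Real.log n := by
    simp [hV, hw0, ← Finset.sum_mul, hstar_sum]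
  have hlog : ∑ i, wstar i * Real.log (w T i) ≤ 0 := by
    refine Finset.sum_nonpos fun i _ => mul_nonpos_of_nonneg_of_nonpos (hstar_pos i) ?_
    refine Real.log_nonpos (hpos T hT.le i).le ?_
    rw [← hsum T hT.le]
    exact Finset.single_le_sum (fun j _ => (hpos T hT.le j).le) (Finset.mem_univ i)
  rw [le_div_iff₀ hT]
  have hVT : V T = T * (f (w T) - f wstar) - ∑ i, wstar i * Real.log (w T i) := rfl
  linarith
end

section
/- Fix t and let w ∈ Δ^n have all coordinates positive, let g ∈ ℝ^n be non-constant, set (Π g)_i = g_i − w·g, η_max = 1/max_i (Π g)_i, and let the update be w'_i = w_i (1 − η (Π g)_i) with η = γ η_max for some γ ∈ (0,1). Then for every u ∈ Δ^n, D(u | w') − D(u | w) ≤ η ∑_i u_i (Π g)_i + C_γ η² ∑_i u_i (Π g)_i², where C_γ = γ^{−2} log(e^{−γ}/(1−γ)). -/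
/-- The function `x ↦ (-x - log (1 - x)) / x ^ 2` is monotone on `(-∞, 1)`, stated without
division so as to include `x = 0`. -/
theorem sq_mul_neg_sub_log_one_sub_le {x y : ℝ} (hxy : x ≤ y) (hy : y < 1) :
    y ^ 2 * (-x - Real.log (1 - x)) ≤ x ^ 2 * (-y - Real.log (1 - y)) := by
  have pos : ∀ z < (1 : ℝ), ∀ s ∈ Set.Icc (0 : ℝ) 1, 0 < 1 - s * z := by
    intro z hz s hs
    rcases le_or_gt z 0 with h | h
    · nlinarith [mul_nonneg hs.1 (neg_nonneg.2 h)]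
    · nlinarith [mul_nonneg (sub_nonneg.2 hs.2) h.le]
  have der : ∀ z < (1 : ℝ), ∀ s ∈ Set.Icc (0 : ℝ) 1,
      HasDerivAt (fun s ↦ -(s * z) - Real.log (1 - s * z)) (s * z ^ 2 / (1 - s * z)) s := by
    intro z hz s hs
    have hp := pos z hz s hs
    have h1 : HasDerivAt (fun s ↦ s * z) z s := by
      simpa using (hasDerivAt_id s).mul_const z
    refine (h1.neg.sub ((h1.const_sub 1).log hp.ne')).congr_deriv ?_
    rw [eq_div_iff hp.ne', sub_mul, div_mul_cancel₀ _ hp.ne']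
    ring
  have derF := fun s hs ↦ ((der x (hxy.trans_lt hy) s hs).const_mul (y ^ 2)).sub
    ((der y hy s hs).const_mul (x ^ 2))
  have anti := antitoneOn_of_deriv_nonpos (convex_Icc (0 : ℝ) 1)
    (fun s hs ↦ (derF s hs).continuousAt.continuousWithinAt)
    (fun s hs ↦ (derF s (interior_subset hs)).differentiableAt.differentiableWithinAt)
    (fun s hs ↦ by
      have hs' := interior_subset hs
      rw [(derF s hs').deriv]
      have hle : s * (x ^ 2 * y ^ 2) / (1 - s * x) ≤ s * (x ^ 2 * y ^ 2) / (1 - s * y) :=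
        div_le_div_of_nonneg_left (mul_nonneg hs'.1 (by positivity)) (pos y hy s hs')
          (by nlinarith [mul_le_mul_of_nonneg_left hxy hs'.1])
      calc _ = s * (x ^ 2 * y ^ 2) / (1 - s * x) - s * (x ^ 2 * y ^ 2) / (1 - s * y) := by ring
        _ ≤ 0 := sub_nonpos.2 hle)
  have key := anti (Set.left_mem_Icc.2 zero_le_one) (Set.right_mem_Icc.2 zero_le_one) zero_le_one
  simp only [Pi.sub_apply, one_mul, zero_mul, neg_zero, sub_zero, Real.log_one, mul_zero] at key
  linarith

/-- Quadratic upper bound for `-log (1 - x)` on `(-∞, y]`, with equality at `x = y`. -/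
theorem neg_log_one_sub_le {x y : ℝ} (hxy : x ≤ y) (hy0 : 0 < y) (hy : y < 1) :
    -Real.log (1 - x) ≤ x + (-y - Real.log (1 - y)) / y ^ 2 * x ^ 2 := by
  have h : -x - Real.log (1 - x) ≤ x ^ 2 * (-y - Real.log (1 - y)) / y ^ 2 := by
    rw [le_div_iff₀ (by positivity)]
    linarith [sq_mul_neg_sub_log_one_sub_le hxy hy]
  calc _ ≤ x + x ^ 2 * (-y - Real.log (1 - y)) / y ^ 2 := by linarith
    _ = _ := by ring

/-- One-step relative-entropy bound for the linear Cauchy-Simplex update: with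
`(Π g)_i = g_i - w·g`, `η = γ η_max`, `η_max = 1/max_i (Π g)_i` and `γ ∈ (0,1)`,
for every `u` in the simplex,
`D(u|w') - D(u|w) ≤ η ∑ u_i (Πg)_i + C_γ η² ∑ u_i (Πg)_i²`,
where `C_γ = γ⁻² log(e^{-γ}/(1-γ)) = (-γ - log(1-γ))/γ²`. -/
theorem cauchy_simplex_relative_entropy_step {n : ℕ} (w g : Fin n → ℝ)
    (hwpos : ∀ i, 0 < w i) (hwsum : ∑ i, w i = 1)
    (hne : (Finset.univ : Finset (Fin n)).Nonempty)
    (Pg : Fin n → ℝ) (hPg : ∀ i, Pg i = g i - ∑ j, w j * g j)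
    (hmax : 0 < Finset.univ.sup' hne Pg)
    (γ : ℝ) (hγ : γ ∈ Set.Ioo (0 : ℝ) 1)
    (η : ℝ) (hη : η = γ * (1 / Finset.univ.sup' hne Pg))
    (w' : Fin n → ℝ) (hw' : ∀ i, w' i = w i * (1 - η * Pg i))
    (u : Fin n → ℝ) (hupos : ∀ i, 0 ≤ u i) (husum : ∑ i, u i = 1) :
    (∑ i, if u i = 0 then (0 : ℝ) else u i * Real.log (u i / w' i))
        - (∑ i, if u i = 0 then (0 : ℝ) else u i * Real.log (u i / w i))
      ≤ η * (∑ i, u i * Pg i)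
        + (-γ - Real.log (1 - γ)) / γ ^ 2 * η ^ 2 * (∑ i, u i * Pg i ^ 2) := by
  have hle : ∀ i, η * Pg i ≤ γ := by
    intro i
    have h : Pg i ≤ Finset.univ.sup' hne Pg := Finset.le_sup' Pg (Finset.mem_univ i)
    rw [hη, mul_assoc, one_div_mul_eq_div]
    exact mul_le_of_le_one_right hγ.1.le ((div_le_one hmax).2 h)
  rw [← Finset.sum_sub_distrib, Finset.mul_sum, Finset.mul_sum, ← Finset.sum_add_distrib]
  refine Finset.sum_le_sum fun i _ ↦ ?_
  split_ifs with hu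
  · simp [hu]
  · have hpos : 0 < 1 - η * Pg i := by linarith [hle i, hγ.2]
    have hbound := mul_le_mul_of_nonneg_left (neg_log_one_sub_le (hle i) hγ.1 hγ.2) (hupos i)
    rw [hw', Real.log_div hu (mul_pos (hwpos i) hpos).ne', Real.log_div hu (hwpos i).ne',
      Real.log_mul (hwpos i).ne' hpos.ne']
    linarith
end

section
/- Let f : ℝ^n → ℝ be convex and differentiable with ∇f L-Lipschitz continuous. Let w ∈ Δ^n, g = ∇f(w), η_max = 1/max_i (g_i − w·g), and w' = w − η w(g − w·g) for some 0 < η ≤ min{1/L, η_max}. Then f(w') ≤ f(w) − (η/2) Var[∇f | w], where Var[∇f | w] = ∑_i w_i (g_i − w·g)². -/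
open scoped InnerProductSpace in
/-- The descent inequality for a differentiable function with `L`-Lipschitz gradient. -/
theorem le_add_inner_gradient_add_sq_of_lipschitz_gradient {E : Type*} [NormedAddCommGroup E]
    [InnerProductSpace ℝ E] [CompleteSpace E] {f : E → ℝ} (hdiff : Differentiable ℝ f)
    {L : ℝ} (hL : ∀ x y, ‖gradient f x - gradient f y‖ ≤ L * ‖x - y‖) (x d : E) :
    f (x + d) ≤ f x + ⟪gradient f x, d⟫_ℝ + L / 2 * ‖d‖ ^ 2 := by
  set φ : ℝ → ℝ := fun t ↦ f (x + t • d) - t * ⟪gradient f x, d⟫_ℝ - L / 2 * ‖d‖ ^ 2 * t ^ 2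
    with hφ
  have hderiv (t : ℝ) : HasDerivAt φ
      (⟪gradient f (x + t • d), d⟫_ℝ - ⟪gradient f x, d⟫_ℝ - L * ‖d‖ ^ 2 * t) t := by
    have hline : HasDerivAt (fun t : ℝ ↦ x + t • d) d t := by
      simpa using ((hasDerivAt_id t).smul_const d).const_add x
    have hf := (hdiff (x + t • d)).hasGradientAt.hasFDerivAt.comp_hasDerivAt t hline
    have hlin := (hasDerivAt_id t).mul_const ⟪gradient f x, d⟫_ℝ
    have hsq := ((hasDerivAt_id t).pow 2).const_mul (L / 2 * ‖d‖ ^ 2)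
    refine ((hf.sub hlin).sub hsq).congr_deriv ?_
    simp
    ring
  have hanti : AntitoneOn φ (Set.Icc 0 1) := by
    refine antitoneOn_of_deriv_nonpos (convex_Icc 0 1)
      (fun t _ ↦ (hderiv t).continuousAt.continuousWithinAt)
      (fun t _ ↦ (hderiv t).differentiableAt.differentiableWithinAt) fun t ht ↦ ?_
    rw [interior_Icc] at ht
    rw [(hderiv t).deriv, ← inner_sub_left]
    have hgrad : ‖gradient f (x + t • d) - gradient f x‖ ≤ L * (t * ‖d‖) := by
      simpa [norm_smul, abs_of_pos ht.1] using hL (x + t • d) x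
    have hmul := mul_le_mul_of_nonneg_right hgrad (norm_nonneg d)
    have hcs := real_inner_le_norm (gradient f (x + t • d) - gradient f x) d
    linarith
  have h01 := hanti (by simp : (0 : ℝ) ∈ Set.Icc 0 1) (by simp : (1 : ℝ) ∈ Set.Icc 0 1) zero_le_one
  simp only [hφ, one_smul, zero_smul, add_zero] at h01
  linarith


/-- Linear progress bound: for convex `f` with `L`-Lipschitz gradient, one Cauchy-Simplex
step `w' = w - η w(∇f - w·∇f)` with `0 < η ≤ min{1/L, η_max}` guarantees
`f(w') ≤ f(w) - (η/2) Var[∇f | w]`, where `Var[∇f | w] = ∑ w_i (∇_i f - w·∇f)²`. -/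
theorem cauchy_simplex_progress_bound {n : ℕ}
    (f : EuclideanSpace ℝ (Fin n) → ℝ)
    (hconv : ConvexOn ℝ Set.univ f) (hdiff : Differentiable ℝ f)
    (L : ℝ) (hL : ∀ x y, ‖gradient f x - gradient f y‖ ≤ L * ‖x - y‖)
    (w : EuclideanSpace ℝ (Fin n)) (hwpos : ∀ i, 0 ≤ w i) (hwsum : ∑ i, w i = 1)
    (hne : (Finset.univ : Finset (Fin n)).Nonempty)
    (g : Fin n → ℝ) (hg : ∀ i, g i = gradient f w i)
    (Pg : Fin n → ℝ) (hPg : ∀ i, Pg i = g i - ∑ j, w j * g j)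
    (η : ℝ) (hη0 : 0 < η)
    (hη : η ≤ min (1 / L) (1 / Finset.univ.sup' hne Pg))
    (w' : EuclideanSpace ℝ (Fin n)) (hw' : ∀ i, w' i = w i - η * (w i * Pg i)) :
    f w' ≤ f w - η / 2 * ∑ i, w i * Pg i ^ 2 := by
  have hηL : η ≤ 1 / L := hη.trans (min_le_left _ _)
  have hLpos : 0 < L := one_div_pos.mp (hη0.trans_le hηL)
  have hLη : L * η ≤ 1 := by rwa [le_div_iff₀ hLpos, mul_comm] at hηL
  have hPgsum : ∑ i, w i * Pg i = 0 := by
    simp only [hPg, mul_sub, Finset.sum_sub_distrib, ← Finset.sum_mul, hwsum, one_mul, sub_self]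
  have hstep (i : Fin n) : (w' - w) i = -η * (w i * Pg i) := by
    rw [PiLp.sub_apply, hw']
    ring
  have hinner : inner ℝ (gradient f w) (w' - w) = -η * ∑ i, w i * Pg i ^ 2 := by
    have hexpand (i : Fin n) : inner ℝ (gradient f w i) ((w' - w) i)
        = -η * (w i * Pg i ^ 2) + -η * (∑ j, w j * g j) * (w i * Pg i) := by
      rw [hstep, ← hg, eq_add_of_sub_eq (hPg i).symm, RCLike.inner_apply, conj_trivial]
      ring
    rw [PiLp.inner_apply, Finset.sum_congr rfl fun i _ ↦ hexpand i, Finset.sum_add_distrib,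
      ← Finset.mul_sum, ← Finset.mul_sum, hPgsum, mul_zero, add_zero]
  have hnorm : ‖w' - w‖ ^ 2 ≤ η ^ 2 * ∑ i, w i * Pg i ^ 2 := by
    rw [EuclideanSpace.norm_sq_eq, Finset.mul_sum]
    refine Finset.sum_le_sum fun i _ ↦ ?_
    have hwle : w i ≤ 1 :=
      hwsum ▸ Finset.single_le_sum (fun j _ ↦ hwpos j) (Finset.mem_univ i)
    rw [hstep, Real.norm_eq_abs, sq_abs]
    calc (-η * (w i * Pg i)) ^ 2 = w i * (η ^ 2 * (w i * Pg i ^ 2)) := by ring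
      _ ≤ η ^ 2 * (w i * Pg i ^ 2) :=
        mul_le_of_le_one_left (mul_nonneg (sq_nonneg η) (mul_nonneg (hwpos i) (sq_nonneg _))) hwle
  have hvar : 0 ≤ ∑ i, w i * Pg i ^ 2 :=
    Finset.sum_nonneg fun i _ ↦ mul_nonneg (hwpos i) (sq_nonneg _)
  have hquad : L / 2 * ‖w' - w‖ ^ 2 ≤ η / 2 * ∑ i, w i * Pg i ^ 2 := by
    calc L / 2 * ‖w' - w‖ ^ 2 ≤ L / 2 * (η ^ 2 * ∑ i, w i * Pg i ^ 2) := by gcongr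
      _ = L * η * (η / 2 * ∑ i, w i * Pg i ^ 2) := by ring
      _ ≤ η / 2 * ∑ i, w i * Pg i ^ 2 := mul_le_of_le_one_left (by positivity) hLη
  have hdescent := le_add_inner_gradient_add_sq_of_lipschitz_gradient hdiff hL w (w' - w)
  rw [add_sub_cancel, hinner] at hdescent
  linarith
end

section
/- Let l^1, …, l^T ∈ [0,1]^N be loss vectors and fix a learning rate η ∈ (0,1). Let w^1 ∈ Δ^N have all coordinates positive and define w^{t+1}_i = w^t_i (1 − η (l^t_i − w^t·l^t)) for t = 1,…,T. Then for every u ∈ Δ^N, ∑_{t=1}^T w^t·l^t − ∑_{t=1}^T u·l^t ≤ D(u|w^1)/η + Tη/(2(1−η)). -/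
/-- A quadratic lower bound for `log (1 - y)` on `[-η, η]`. -/
lemma neg_sub_sq_div_le_log_one_sub {η y : ℝ} (hη : η < 1) (hyη : |y| ≤ η) :
    -y - y ^ 2 / (2 * (1 - η)) ≤ Real.log (1 - y) := by
  obtain ⟨hlo, hhi⟩ := abs_le.1 hyη
  rcases le_total 0 y with hy | hy
  · have hz : 0 < 1 - y := by linarith
    have hlog : Real.log (1 - y)⁻¹ ≤ Real.sinh (Real.log (1 - y)⁻¹) := by
      rw [Real.self_le_sinh_iff]
      exact Real.log_nonneg ((one_le_inv₀ hz).2 (by linarith))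
    rw [Real.sinh_eq, Real.exp_neg, Real.exp_log (inv_pos.2 hz), inv_inv, Real.log_inv] at hlog
    have hquad : ((1 - y)⁻¹ - (1 - y)) / 2 = y + y ^ 2 / (2 * (1 - y)) := by
      field_simp
      ring
    have hmono : y ^ 2 / (2 * (1 - y)) ≤ y ^ 2 / (2 * (1 - η)) := by
      have : 0 < 1 - η := by linarith
      gcongr
    linarith
  · have hlog := Real.le_log_one_add_of_nonneg (neg_nonneg.2 hy)
    have hquad : -y - y ^ 2 / 2 ≤ 2 * -y / (-y + 2) := by
      rw [le_div_iff₀ (by linarith)]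
      nlinarith [mul_nonneg (neg_nonneg.2 hy) (sq_nonneg y)]
    have hmono : y ^ 2 / 2 ≤ y ^ 2 / (2 * (1 - η)) := by
      gcongr; linarith
    rw [← sub_eq_add_neg] at hlog
    linarith

/-- Gibbs' inequality, stated relative to a reference vector `r`. -/
lemma sum_mul_log_sub_log_le_relative_entropy {ι : Type*} [Fintype ι] {u p r : ι → ℝ}
    (hu : ∀ i, 0 ≤ u i) (hp : ∀ i, 0 < p i) (hr : ∀ i, 0 < r i)
    (hsum : ∑ i, p i ≤ ∑ i, u i) :
    ∑ i, u i * (Real.log (p i) - Real.log (r i))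
      ≤ ∑ i, if u i = 0 then (0 : ℝ) else u i * Real.log (u i / r i) := by
  have hterm : ∀ i, u i * (Real.log (p i) - Real.log (r i))
      ≤ (if u i = 0 then (0 : ℝ) else u i * Real.log (u i / r i)) + (p i - u i) := by
    intro i
    split_ifs with h
    · simp [h, (hp i).le]
    · have hui : 0 < u i := lt_of_le_of_ne (hu i) (Ne.symm h)
      have hlog := Real.log_le_sub_one_of_pos (div_pos (hp i) hui)
      rw [Real.log_div (hp i).ne' h] at hlog
      rw [Real.log_div h (hr i).ne']
      have hmul := mul_le_mul_of_nonneg_left hlog hui.le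
      have hcancel : u i * (p i / u i - 1) = p i - u i := by field_simp
      linarith
  have hle := Finset.sum_le_sum fun i (_ : i ∈ Finset.univ) => hterm i
  rw [Finset.sum_add_distrib, Finset.sum_sub_distrib] at hle
  linarith

/-- The excess loss of an expert over the average loss lies in `[-1, 1]`. -/
lemma abs_sub_sum_mul_le_one {ι : Type*} [Fintype ι] {p l : ι → ℝ}
    (hl : ∀ i, l i ∈ Set.Icc (0 : ℝ) 1) (hp : ∀ i, 0 ≤ p i) (hsum : ∑ i, p i = 1) (i : ι) :
    |l i - ∑ j, p j * l j| ≤ 1 := by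
  have h0 : 0 ≤ ∑ j, p j * l j := Finset.sum_nonneg fun j _ => mul_nonneg (hp j) (hl j).1
  have h1 : ∑ j, p j * l j ≤ 1 :=
    hsum ▸ Finset.sum_le_sum fun j _ => mul_le_of_le_one_right (hp j) (hl j).2
  have hi := hl i
  rw [abs_le]
  constructor <;> linarith [hi.1, hi.2]

/-- A Cauchy-Simplex step stays in the interior of the simplex, and the instantaneous regret
against `u` is controlled by the increase of `∑ i, u i * log (w i)`. -/
lemma cauchy_simplex_step {ι : Type*} [Fintype ι] {l p q u : ι → ℝ} {η : ℝ}
    (hη : η ∈ Set.Ioo (0 : ℝ) 1) (hl : ∀ i, l i ∈ Set.Icc (0 : ℝ) 1)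
    (hp : ∀ i, 0 < p i) (hsum : ∑ i, p i = 1)
    (hq : ∀ i, q i = p i * (1 - η * (l i - ∑ j, p j * l j)))
    (hu : ∀ i, 0 ≤ u i) (husum : ∑ i, u i = 1) :
    (∀ i, 0 < q i) ∧ ∑ i, q i = 1 ∧
      η * (∑ i, p i * l i - ∑ i, u i * l i)
        ≤ ∑ i, u i * (Real.log (q i) - Real.log (p i)) + η ^ 2 / (2 * (1 - η)) := by
  obtain ⟨hη0, hη1⟩ := hη
  have habs := abs_sub_sum_mul_le_one hl (fun i => (hp i).le) hsum
  set m := ∑ j, p j * l j with hm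
  have hy : ∀ i, |η * (l i - m)| ≤ η := fun i => by
    rw [abs_mul, abs_of_pos hη0]
    exact mul_le_of_le_one_right hη0.le (habs i)
  have hfac : ∀ i, 0 < 1 - η * (l i - m) := fun i => by
    linarith [(abs_le.1 (hy i)).2]
  refine ⟨fun i => hq i ▸ mul_pos (hp i) (hfac i), ?_, ?_⟩
  · have hexp : ∀ i, q i = p i - η * (p i * l i) + η * m * p i := fun i => by
      rw [hq i]
      ring
    simp only [hexp, Finset.sum_add_distrib, Finset.sum_sub_distrib, ← Finset.mul_sum, hsum, ← hm]
    ring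
  · have hterm : ∀ i, -η * (u i * l i) + η * m * u i - η ^ 2 / (2 * (1 - η)) * u i
        ≤ u i * (Real.log (q i) - Real.log (p i)) := by
      intro i
      have hlog := neg_sub_sq_div_le_log_one_sub hη1 (hy i)
      have hsq : (η * (l i - m)) ^ 2 / (2 * (1 - η)) ≤ η ^ 2 / (2 * (1 - η)) := by
        have hpos : 0 < 1 - η := by linarith
        have := sq_le_sq' (abs_le.1 (hy i)).1 (abs_le.1 (hy i)).2
        gcongr
      rw [hq i, Real.log_mul (hp i).ne' (hfac i).ne']
      have := mul_le_mul_of_nonneg_left (hlog.trans' (sub_le_sub_left hsq _)) (hu i)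
      linarith
    have hle := Finset.sum_le_sum fun i (_ : i ∈ Finset.univ) => hterm i
    simp only [Finset.sum_add_distrib, Finset.sum_sub_distrib, ← Finset.mul_sum, husum] at hle
    linarith


/-- Regret bound for prediction with expert advice via the Cauchy-Simplex: for losses
`l^t ∈ [0,1]^N`, fixed learning rate `η ∈ (0,1)`, and updates
`w^{t+1}_i = w^t_i (1 - η (l^t_i - w^t·l^t))` starting from `w^1` in the interior of the
simplex, the regret against any `u ∈ Δ^N` is at most `D(u|w^1)/η + Tη/(2(1-η))`. -/
theorem cauchy_simplex_expert_advice_regret {N : ℕ} (T : ℕ) (l : ℕ → Fin N → ℝ)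
    (hl : ∀ t ∈ Finset.Icc 1 T, ∀ i, l t i ∈ Set.Icc (0 : ℝ) 1)
    (η : ℝ) (hη : η ∈ Set.Ioo (0 : ℝ) 1)
    (w : ℕ → Fin N → ℝ)
    (hw1pos : ∀ i, 0 < w 1 i) (hw1sum : ∑ i, w 1 i = 1)
    (hupdate : ∀ t ∈ Finset.Icc 1 T, ∀ i,
      w (t + 1) i = w t i * (1 - η * (l t i - ∑ j, w t j * l t j)))
    (u : Fin N → ℝ) (hupos : ∀ i, 0 ≤ u i) (husum : ∑ i, u i = 1) :
    (∑ t ∈ Finset.Icc 1 T, ∑ i, w t i * l t i) - ∑ t ∈ Finset.Icc 1 T, ∑ i, u i * l t i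
      ≤ (∑ i, if u i = 0 then (0 : ℝ) else u i * Real.log (u i / w 1 i)) / η
        + T * η / (2 * (1 - η)) := by
  have key : ∀ n ≤ T, (∀ i, 0 < w (n + 1) i) ∧ ∑ i, w (n + 1) i = 1 ∧
      η * ((∑ t ∈ Finset.Icc 1 n, ∑ i, w t i * l t i)
          - ∑ t ∈ Finset.Icc 1 n, ∑ i, u i * l t i)
        ≤ ∑ i, u i * (Real.log (w (n + 1) i) - Real.log (w 1 i))
          + n * (η ^ 2 / (2 * (1 - η))) := by
    intro n
    induction n with
    | zero => intro _; simpa using ⟨hw1pos, hw1sum⟩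
    | succ n ih =>
      intro hn
      obtain ⟨hpos, hsum, hreg⟩ := ih (by omega)
      have hmem : n + 1 ∈ Finset.Icc 1 T := Finset.mem_Icc.2 ⟨by omega, hn⟩
      obtain ⟨hpos', hsum', hstep⟩ :=
        cauchy_simplex_step hη (hl _ hmem) hpos hsum (hupdate _ hmem) hupos husum
      refine ⟨hpos', hsum', ?_⟩
      rw [Finset.sum_Icc_succ_top (by omega), Finset.sum_Icc_succ_top (by omega)]
      push_cast
      simp only [mul_sub, Finset.sum_sub_distrib] at hreg hstep ⊢
      linarith
  obtain ⟨hpos, hsum, hreg⟩ := key T le_rfl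
  have hent := sum_mul_log_sub_log_le_relative_entropy hupos hpos hw1pos (hsum.trans husum.symm).le
  have hη0 : 0 < η := hη.1
  have hη1 : 0 < 1 - η := sub_pos.2 hη.2
  refine le_of_mul_le_mul_left ((hreg.trans (add_le_add_left hent _)).trans_eq ?_) hη0
  field_simp
end

section
/- Let l^1, …, l^T ∈ [0,1]^N be loss vectors, let w^1 = (1/N,…,1/N), set η = √(2 log N) / (√(2 log N) + √T), and define w^{t+1}_i = w^t_i (1 − η (l^t_i − w^t·l^t)) for t = 1,…,T. Then for every u ∈ Δ^N (in particular for u = e_j with j the best expert), ∑_{t=1}^T w^t·l^t − ∑_{t=1}^T u·l^t ≤ √(2 T log N) + log N. -/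
theorem neg_sub_sq_div_two_le_log_one_sub {y η : ℝ} (hη0 : 0 ≤ η) (hη1 : η < 1) (hy : y ≤ η) :
    -y - y ^ 2 / (2 * (1 - η)) ≤ Real.log (1 - y) := by
  have hη : 0 < 1 - η := by linarith
  rcases le_total 0 y with h | h
  · have hy1 : 0 < 1 - y := by linarith
    have hmono : y ^ 2 / (2 * (1 - y)) ≤ y ^ 2 / (2 * (1 - η)) := by gcongr
    have hlog : 0 ≤ -Real.log (1 - y) := by
      linarith [Real.log_nonpos hy1.le (by linarith)]
    have hsinh := Real.self_le_sinh_iff.mpr hlog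
    rw [Real.sinh_eq, neg_neg, Real.exp_neg, Real.exp_log hy1] at hsinh
    have heq : ((1 - y)⁻¹ - (1 - y)) / 2 = y + y ^ 2 / (2 * (1 - y)) := by
      field_simp
      ring
    linarith
  · have hlog := Real.le_log_one_add_of_nonneg (x := -y) (by linarith)
    have hrat : -y - y ^ 2 / 2 ≤ 2 * -y / (-y + 2) := by
      rw [le_div_iff₀ (by linarith)]
      nlinarith [mul_nonneg (neg_nonneg.mpr h) (sq_nonneg y)]
    have hmono : y ^ 2 / 2 ≤ y ^ 2 / (2 * (1 - η)) := by
      gcongr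
      linarith
    rw [← sub_eq_add_neg] at hlog
    linarith

theorem sum_mul_mem_Icc {ι : Type*} [Fintype ι] {p x : ι → ℝ} (hp : ∀ i, 0 ≤ p i)
    (hsum : ∑ i, p i = 1) (hx : ∀ i, x i ∈ Set.Icc (0 : ℝ) 1) :
    ∑ i, p i * x i ∈ Set.Icc (0 : ℝ) 1 := by
  refine ⟨Finset.sum_nonneg fun i _ => mul_nonneg (hp i) (hx i).1, ?_⟩
  rw [← hsum]
  exact Finset.sum_le_sum fun i _ => mul_le_of_le_one_right (hp i) (hx i).2

/-- The Cauchy-Simplex iterates stay in the open simplex, and the logarithm of each weight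
is bounded below by the accumulated regret against the corresponding expert. -/
theorem cauchySimplex_invariant {N : ℕ} (hN : 0 < N) (T : ℕ) (l : ℕ → Fin N → ℝ)
    (hl : ∀ t ∈ Finset.Icc 1 T, ∀ i, l t i ∈ Set.Icc (0 : ℝ) 1)
    {η : ℝ} (hη0 : 0 ≤ η) (hη1 : η < 1)
    (w : ℕ → Fin N → ℝ) (hw1 : ∀ i, w 1 i = 1 / N)
    (hupdate : ∀ t ∈ Finset.Icc 1 T, ∀ i,
      w (t + 1) i = w t i * (1 - η * (l t i - ∑ j, w t j * l t j)))
    (k : ℕ) (hk : k ≤ T) :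
    (∀ i, 0 < w (k + 1) i) ∧ ∑ i, w (k + 1) i = 1 ∧
      ∀ i, -Real.log N + η * ∑ t ∈ Finset.Icc 1 k, (∑ j, w t j * l t j - l t i)
        - k * (η ^ 2 / (2 * (1 - η))) ≤ Real.log (w (k + 1) i) := by
  have hη : 0 < 1 - η := by linarith
  induction k with
  | zero =>
    have hN' : (0 : ℝ) < N := by exact_mod_cast hN
    refine ⟨fun i => ?_, ?_, fun i => ?_⟩
    · rw [hw1]
      positivity
    · simp [hw1, hN'.ne']
    · simp [hw1]
  | succ k ih =>
    obtain ⟨hpos, hsum, hlog⟩ := ih (by omega)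
    have hmem : k + 1 ∈ Finset.Icc 1 T := Finset.mem_Icc.mpr ⟨by omega, hk⟩
    have hmean := sum_mul_mem_Icc (fun i => (hpos i).le) hsum (hl _ hmem)
    have hup := hupdate _ hmem
    have hsum' : ∑ i, w (k + 1 + 1) i = 1 := by
      simp_rw [hup, mul_sub, mul_one, Finset.sum_sub_distrib, mul_left_comm _ η,
        ← Finset.mul_sum, ← Finset.sum_mul, hsum]
      ring
    set m := ∑ j, w (k + 1) j * l (k + 1) j
    have hle (i) : η * (l (k + 1) i - m) ≤ η :=
      mul_le_of_le_one_right hη0 (by linarith [(hl _ hmem i).2, hmean.1])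
    have hfac (i) : 0 < 1 - η * (l (k + 1) i - m) := by linarith [hle i]
    refine ⟨fun i => hup i ▸ mul_pos (hpos i) (hfac i), hsum', fun i => ?_⟩
    rw [hup, Real.log_mul (hpos i).ne' (hfac i).ne', Finset.sum_Icc_succ_top (by omega)]
    have hstep := neg_sub_sq_div_two_le_log_one_sub hη0 hη1 (hle i)
    have hsq : (η * (l (k + 1) i - m)) ^ 2 / (2 * (1 - η)) ≤ η ^ 2 / (2 * (1 - η)) := by
      refine div_le_div_of_nonneg_right ?_ (by positivity)
      rw [mul_pow]
      refine mul_le_of_le_one_right (sq_nonneg η) ((sq_le_one_iff_abs_le_one _).mpr ?_)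
      rw [abs_le]
      constructor <;> linarith [(hl _ hmem i).1, (hl _ hmem i).2, hmean.1, hmean.2]
    have hi := hlog i
    push_cast
    linarith

theorem tuned_rate_bound {L t R : ℝ} (hL : 0 < L) (ht : 0 < t) {η : ℝ}
    (hη : η = √(2 * L) / (√(2 * L) + √t))
    (hR : η * R ≤ L + t * (η ^ 2 / (2 * (1 - η)))) :
    R ≤ √(2 * t * L) + L := by
  have hs : 0 < √(2 * L) := by positivity
  have hr : 0 < √t := by positivity
  have hprod : √(2 * t * L) = √(2 * L) * √t := by
    rw [← Real.sqrt_mul (by positivity)]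
    congr 1
    ring
  have hs2 : √(2 * L) ^ 2 = 2 * L := Real.sq_sqrt (by positivity)
  have hr2 : √t ^ 2 = t := Real.sq_sqrt ht.le
  rw [hprod]
  generalize √(2 * L) = s at *
  generalize √t = r at *
  obtain rfl : L = s ^ 2 / 2 := by linarith
  subst hr2
  have hη0 : 0 < η := by rw [hη]; positivity
  refine le_of_mul_le_mul_left (hR.trans_eq ?_) hη0
  have hη' : 1 - η = r / (s + r) := by
    rw [hη]
    field_simp
    ring
  rw [hη', hη]
  field_simp
  ring

/-- Tuned regret bound for prediction with expert advice via the Cauchy-Simplex: with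
uniform initialization and `η = √(2 log N)/(√(2 log N) + √T)`, the regret against any
`u ∈ Δ^N` (in particular the best expert `e_j`) is at most `√(2 T log N) + log N`. -/
theorem cauchy_simplex_expert_advice_regret_tuned {N : ℕ} (hN : 0 < N)
    (T : ℕ) (l : ℕ → Fin N → ℝ)
    (hl : ∀ t ∈ Finset.Icc 1 T, ∀ i, l t i ∈ Set.Icc (0 : ℝ) 1)
    (η : ℝ) (hη : η = Real.sqrt (2 * Real.log N) / (Real.sqrt (2 * Real.log N) + Real.sqrt T))
    (w : ℕ → Fin N → ℝ) (hw1 : ∀ i, w 1 i = 1 / N)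
    (hupdate : ∀ t ∈ Finset.Icc 1 T, ∀ i,
      w (t + 1) i = w t i * (1 - η * (l t i - ∑ j, w t j * l t j)))
    (u : Fin N → ℝ) (hupos : ∀ i, 0 ≤ u i) (husum : ∑ i, u i = 1) :
    (∑ t ∈ Finset.Icc 1 T, ∑ i, w t i * l t i) - ∑ t ∈ Finset.Icc 1 T, ∑ i, u i * l t i
      ≤ Real.sqrt (2 * T * Real.log N) + Real.log N := by
  rcases Nat.eq_zero_or_pos T with rfl | hT
  · simpa using Real.log_natCast_nonneg N
  have hT' : (0 : ℝ) < T := by exact_mod_cast hT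
  have hη0 : 0 ≤ η := by rw [hη]; positivity
  have hη1 : η < 1 := by
    rw [hη, div_lt_one (by positivity)]
    linarith [Real.sqrt_pos.mpr hT']
  have hinv := cauchySimplex_invariant hN T l hl hη0 hη1 w hw1 hupdate
  obtain rfl | hN1 : N = 1 ∨ 1 < N := by omega
  · have hw (t) (ht : t ∈ Finset.Icc 1 T) : w t 0 = 1 := by
      obtain ⟨h1, h2⟩ := Finset.mem_Icc.mp ht
      have hsum := (hinv (t - 1) (by omega)).2.1
      rw [Nat.sub_add_cancel h1] at hsum
      simpa using hsum
    have hu : u 0 = 1 := by simpa using husum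
    have hsum : ∑ t ∈ Finset.Icc 1 T, w t 0 * l t 0 = ∑ t ∈ Finset.Icc 1 T, u 0 * l t 0 :=
      Finset.sum_congr rfl fun t ht => by rw [hw t ht, hu]
    simp [hsum]
  · obtain ⟨hpos, hsum, hlog⟩ := hinv T le_rfl
    have hL : 0 < Real.log N := Real.log_pos (by exact_mod_cast hN1)
    have hexpert (i) : ∑ t ∈ Finset.Icc 1 T, (∑ j, w t j * l t j - l t i)
        ≤ √(2 * T * Real.log N) + Real.log N := by
      refine tuned_rate_bound hL hT' hη ?_
      have hle : w (T + 1) i ≤ 1 :=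
        hsum ▸ Finset.single_le_sum (fun j _ => (hpos j).le) (Finset.mem_univ i)
      linarith [hlog i, Real.log_nonpos (hpos i).le hle]
    calc _ = ∑ i, u i * ∑ t ∈ Finset.Icc 1 T, (∑ j, w t j * l t j - l t i) := by
          simp_rw [Finset.sum_sub_distrib, mul_sub, Finset.sum_sub_distrib, ← Finset.sum_mul,
            husum, one_mul, Finset.mul_sum]
          rw [Finset.sum_comm (f := fun i t => u i * l t i)]
      _ ≤ ∑ i, u i * (√(2 * T * Real.log N) + Real.log N) :=
          Finset.sum_le_sum fun i _ => mul_le_mul_of_nonneg_left (hexpert i) (hupos i)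
      _ = _ := by rw [← Finset.sum_mul, husum, one_mul]
end

section
/- Let x^1, …, x^T be price relative vectors with x^t ∈ [a,1]^N for some 0 < a ≤ 1 and max_i x^t_i = 1 for each t. Fix η ∈ (0,1), let w^1 ∈ Δ^N have all coordinates positive, and define w^{t+1}_i = w^t_i (1 + η (x^t_i/(w^t·x^t) − 1)) for t = 1,…,T. Then for every u ∈ Δ^N, ∑_{t=1}^T log(u·x^t) − ∑_{t=1}^T log(w^t·x^t) ≤ D(u|w^1)/η + Tη/(2a²(1−η)). -/
/-- A quadratic lower bound for `log (1 + y)` on `[-η, ∞)`. -/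
theorem sub_sq_div_le_log_one_add {η y : ℝ} (hη0 : 0 ≤ η) (hη1 : η < 1) (hy : -η ≤ y) :
    y - y ^ 2 / (2 * (1 - η)) ≤ Real.log (1 + y) := by
  rcases le_total 0 y with h | h
  · have h1 : y ^ 2 / (y + 2) ≤ y ^ 2 / (2 * (1 - η)) := by
      apply div_le_div_of_nonneg_left (sq_nonneg y) <;> linarith
    have h2 : y - y ^ 2 / (y + 2) = 2 * y / (y + 2) := by
      field_simp
      ring
    linarith [Real.le_log_one_add_of_nonneg h]
  · have hpos : 0 < 1 + y := by linarith
    have h1 : y ^ 2 / (2 * (1 + y)) ≤ y ^ 2 / (2 * (1 - η)) := by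
      apply div_le_div_of_nonneg_left (sq_nonneg y) <;> linarith
    have h2 : -Real.log (1 + y) ≤ Real.sinh (-Real.log (1 + y)) :=
      Real.self_le_sinh_iff.2 (by linarith [Real.log_nonpos hpos.le (by linarith)])
    rw [Real.sinh_neg, Real.sinh_log hpos] at h2
    have h3 : (1 + y - (1 + y)⁻¹) / 2 = y - y ^ 2 / (2 * (1 + y)) := by
      field_simp
      ring
    linarith

/-- The relative entropy `∑ i, u i * log (u i / w i)`, with the convention `0 log 0 = 0`. -/
noncomputable def relativeEntropy {ι : Type*} [Fintype ι] (u w : ι → ℝ) : ℝ :=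
  ∑ i, if u i = 0 then (0 : ℝ) else u i * Real.log (u i / w i)

theorem relativeEntropy_nonneg {ι : Type*} [Fintype ι] {u w : ι → ℝ} (hu : ∀ i, 0 ≤ u i)
    (hw : ∀ i, 0 < w i) (h : ∑ i, u i = ∑ i, w i) : 0 ≤ relativeEntropy u w := by
  calc (0 : ℝ) = ∑ i, (u i - w i) := by rw [Finset.sum_sub_distrib, h, sub_self]
    _ ≤ relativeEntropy u w := Finset.sum_le_sum fun i _ => by
      split_ifs with h0
      · linarith [hw i]
      · have hui : 0 < u i := lt_of_le_of_ne (hu i) (Ne.symm h0)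
        have hlog := mul_le_mul_of_nonneg_left
          (Real.one_sub_inv_le_log_of_pos (div_pos hui (hw i))) hui.le
        have heq : u i * (1 - (u i / w i)⁻¹) = u i - w i := by
          field_simp
        linarith

theorem relativeEntropy_sub_relativeEntropy_mul {ι : Type*} [Fintype ι] {u w c : ι → ℝ}
    (hw : ∀ i, 0 < w i) (hc : ∀ i, 0 < c i) :
    relativeEntropy u w - relativeEntropy u (fun i => w i * c i) =
      ∑ i, u i * Real.log (c i) := by
  rw [relativeEntropy, relativeEntropy, ← Finset.sum_sub_distrib]
  refine Finset.sum_congr rfl fun i _ => ?_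
  split_ifs with h0
  · simp [h0]
  · rw [Real.log_div h0 (hw i).ne', Real.log_div h0 (mul_pos (hw i) (hc i)).ne',
      Real.log_mul (hw i).ne' (hc i).ne']
    ring

section PortfolioUpdate

variable {ι : Type*} [Fintype ι] {a η : ℝ} {u w x : ι → ℝ}

theorem le_sum_mul_of_forall_le (hw : ∀ i, 0 ≤ w i) (hsum : ∑ i, w i = 1)
    (hx : ∀ i, a ≤ x i) : a ≤ ∑ i, w i * x i := by
  calc a = ∑ i, w i * a := by rw [← Finset.sum_mul, hsum, one_mul]
    _ ≤ _ := Finset.sum_le_sum fun i _ => mul_le_mul_of_nonneg_left (hx i) (hw i)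

theorem portfolio_factor_pos (hη0 : 0 ≤ η) (hη1 : η < 1) {r : ℝ} (hr : 0 ≤ r) :
    0 < 1 + η * (r - 1) := by
  nlinarith [mul_nonneg hη0 hr]

theorem sum_portfolio_update (hsum : ∑ i, w i = 1) (hs : ∑ j, w j * x j ≠ 0) :
    ∑ i, w i * (1 + η * (x i / (∑ j, w j * x j) - 1)) = 1 := by
  set s := ∑ j, w j * x j with hsdef
  calc ∑ i, w i * (1 + η * (x i / s - 1))
      = ∑ i, ((1 - η) * w i + η / s * (w i * x i)) :=
        Finset.sum_congr rfl fun i _ => by ring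
    _ = 1 := by
      rw [Finset.sum_add_distrib, ← Finset.mul_sum, ← Finset.mul_sum, hsum, ← hsdef,
        div_mul_cancel₀ _ hs]
      ring

/-- One step of the Cauchy-Simplex portfolio update decreases the relative entropy to `u` by
`η` times the log-regret incurred in that step, up to a second-order error. -/
theorem portfolio_step_log_regret_le (ha : 0 < a) (hη0 : 0 ≤ η) (hη1 : η < 1)
    (hx : ∀ i, x i ∈ Set.Icc a 1) (hw : ∀ i, 0 < w i) (hwsum : ∑ i, w i = 1)
    (hu : ∀ i, 0 ≤ u i) (husum : ∑ i, u i = 1) :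
    η * (Real.log (∑ i, u i * x i) - Real.log (∑ i, w i * x i)) ≤
      relativeEntropy u w
        - relativeEntropy u (fun i => w i * (1 + η * (x i / (∑ j, w j * x j) - 1)))
        + η ^ 2 / (2 * a ^ 2 * (1 - η)) := by
  have hsa : a ≤ ∑ j, w j * x j :=
    le_sum_mul_of_forall_le (fun i => (hw i).le) hwsum fun i => (hx i).1
  have hua : a ≤ ∑ j, u j * x j := le_sum_mul_of_forall_le hu husum fun i => (hx i).1
  set s := ∑ j, w j * x j
  have hs : 0 < s := ha.trans_le hsa
  have hr : ∀ i, 0 ≤ x i / s := fun i => div_nonneg (ha.le.trans (hx i).1) hs.le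
  rw [relativeEntropy_sub_relativeEntropy_mul hw
    fun i => portfolio_factor_pos hη0 hη1 (hr i)]
  have hlog : Real.log (∑ i, u i * x i) - Real.log s ≤ ∑ i, u i * (x i / s - 1) := by
    rw [← Real.log_div (ha.trans_le hua).ne' hs.ne']
    refine (Real.log_le_sub_one_of_pos (div_pos (ha.trans_le hua) hs)).trans_eq ?_
    simp_rw [mul_sub, mul_one, Finset.sum_sub_distrib, husum, Finset.sum_div, mul_div_assoc]
  have hterm : ∀ i, u i * (η * (x i / s - 1) - η ^ 2 / (2 * a ^ 2 * (1 - η))) ≤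
      u i * Real.log (1 + η * (x i / s - 1)) := fun i => by
    refine mul_le_mul_of_nonneg_left ?_ (hu i)
    refine le_trans ?_ (sub_sq_div_le_log_one_add hη0 hη1
      (by nlinarith [mul_nonneg hη0 (hr i)] : -η ≤ η * (x i / s - 1)))
    have hle : x i / s ≤ 1 / a := div_le_div₀ zero_le_one (hx i).2 ha hsa
    have ha1 : 1 ≤ 1 / a := (one_le_div ha).2 ((hx i).1.trans (hx i).2)
    have hz : (x i / s - 1) ^ 2 ≤ (1 / a) ^ 2 :=
      sq_le_sq' (by linarith [hr i]) (by linarith)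
    have hη : 0 < 2 * (1 - η) := by linarith
    calc η * (x i / s - 1) - η ^ 2 / (2 * a ^ 2 * (1 - η))
        = η * (x i / s - 1) - η ^ 2 * (1 / a) ^ 2 / (2 * (1 - η)) := by
          have : 1 - η ≠ 0 := by linarith
          field_simp
      _ ≤ η * (x i / s - 1) - (η * (x i / s - 1)) ^ 2 / (2 * (1 - η)) := by
          rw [mul_pow]
          gcongr
  have hsum := Finset.sum_le_sum fun i (_ : i ∈ Finset.univ) => hterm i
  simp_rw [mul_sub (u _) (η * _), Finset.sum_sub_distrib, ← Finset.sum_mul, husum,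
    mul_left_comm (u _) η, ← Finset.mul_sum, one_mul] at hsum
  linarith [mul_le_mul_of_nonneg_left hlog hη0]

end PortfolioUpdate


/-- Log-regret bound for the Cauchy-Simplex universal portfolio: for price relatives
`x^t ∈ [a,1]^N` with `max_i x^t_i = 1`, fixed `η ∈ (0,1)`, and updates
`w^{t+1}_i = w^t_i (1 + η (x^t_i/(w^t·x^t) - 1))` from an interior starting portfolio,
the log-regret against any `u ∈ Δ^N` is at most `D(u|w^1)/η + Tη/(2a²(1-η))`. -/
theorem cauchy_simplex_portfolio_log_regret {N : ℕ} (T : ℕ)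
    (a : ℝ) (ha0 : 0 < a) (ha1 : a ≤ 1)
    (x : ℕ → Fin N → ℝ)
    (hx : ∀ t ∈ Finset.Icc 1 T, ∀ i, x t i ∈ Set.Icc a 1)
    (hxmax : ∀ t ∈ Finset.Icc 1 T, ∃ i, x t i = 1)
    (η : ℝ) (hη : η ∈ Set.Ioo (0 : ℝ) 1)
    (w : ℕ → Fin N → ℝ)
    (hw1pos : ∀ i, 0 < w 1 i) (hw1sum : ∑ i, w 1 i = 1)
    (hupdate : ∀ t ∈ Finset.Icc 1 T, ∀ i,
      w (t + 1) i = w t i * (1 + η * (x t i / (∑ j, w t j * x t j) - 1)))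
    (u : Fin N → ℝ) (hupos : ∀ i, 0 ≤ u i) (husum : ∑ i, u i = 1) :
    (∑ t ∈ Finset.Icc 1 T, Real.log (∑ i, u i * x t i))
        - ∑ t ∈ Finset.Icc 1 T, Real.log (∑ i, w t i * x t i)
      ≤ (∑ i, if u i = 0 then (0 : ℝ) else u i * Real.log (u i / w 1 i)) / η
        + T * η / (2 * a ^ 2 * (1 - η)) := by
  obtain ⟨hη0, hη1⟩ := hη
  have hcum : ∀ n ≤ T, (∀ i, 0 < w (n + 1) i) ∧ ∑ i, w (n + 1) i = 1 ∧
      η * ((∑ t ∈ Finset.Icc 1 n, Real.log (∑ i, u i * x t i))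
        - ∑ t ∈ Finset.Icc 1 n, Real.log (∑ i, w t i * x t i)) ≤
      relativeEntropy u (w 1) - relativeEntropy u (w (n + 1))
        + n * (η ^ 2 / (2 * a ^ 2 * (1 - η))) := by
    intro n
    induction n with
    | zero => simpa using ⟨hw1pos, hw1sum⟩
    | succ n ih =>
      intro hn
      obtain ⟨hpos, hsum, hregret⟩ := ih (by omega)
      have hmem : n + 1 ∈ Finset.Icc 1 T := Finset.mem_Icc.2 ⟨by omega, hn⟩
      have hs : 0 < ∑ j, w (n + 1) j * x (n + 1) j := ha0.trans_le <|
        le_sum_mul_of_forall_le (fun i => (hpos i).le) hsum fun i => (hx _ hmem i).1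
      have hstep := portfolio_step_log_regret_le ha0 hη0.le hη1 (hx _ hmem) hpos hsum hupos husum
      have hw := funext (hupdate _ hmem)
      rw [← hw] at hstep
      refine ⟨fun i => ?_, ?_, ?_⟩
      · rw [hupdate _ hmem]
        exact mul_pos (hpos i) (portfolio_factor_pos hη0.le hη1
          (div_nonneg (ha0.le.trans (hx _ hmem i).1) hs.le))
      · rw [hw]
        exact sum_portfolio_update hsum hs.ne'
      · rw [Finset.sum_Icc_succ_top (by omega), Finset.sum_Icc_succ_top (by omega)]
        push_cast
        linarith
  obtain ⟨hpos, hsum, hregret⟩ := hcum T le_rfl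
  have hnonneg := relativeEntropy_nonneg hupos hpos (husum.trans hsum.symm)
  change _ ≤ relativeEntropy u (w 1) / η + _
  have heq : relativeEntropy u (w 1) / η + T * η / (2 * a ^ 2 * (1 - η)) =
      (relativeEntropy u (w 1) + T * (η ^ 2 / (2 * a ^ 2 * (1 - η)))) / η := by
    field_simp
  rw [heq, le_div_iff₀ hη0]
  linarith
end

section
/- Let ψ : ℝ → ℝ^n be differentiable with ψ(t) ≠ 0, and suppose ψ satisfies the gradient-descent ODE dψ/dt = −α ∂(f∘w)/∂ψ for a differentiable f : ℝ^n → ℝ and constant α > 0, where w : ℝ → ℝ^n is defined by w_i = ψ_i² / ∑_j ψ_j². Then w satisfies dw_i/dt = −β(t) w_i (∇_i f(w) − w·∇f(w)), where β(t) = 4α/‖ψ(t)‖². -/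
theorem EuclideanSpace.fderiv_apply_eq_sum_gradient {n : ℕ} (F : EuclideanSpace ℝ (Fin n) → ℝ)
    (x v : EuclideanSpace ℝ (Fin n)) :
    fderiv ℝ F x v = ∑ k, v k * gradient F x k := by
  have h : inner ℝ (gradient F x) v = fderiv ℝ F x v := by
    simp only [gradient, InnerProductSpace.toDual_symm_apply]
  rw [← h, PiLp.inner_apply]
  simp

/-- Coordinates of the gradient on Euclidean space are directional derivatives. -/
theorem EuclideanSpace.gradient_apply {n : ℕ} (F : EuclideanSpace ℝ (Fin n) → ℝ)
    (x : EuclideanSpace ℝ (Fin n)) (i : Fin n) :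
    gradient F x i = fderiv ℝ F x (EuclideanSpace.single i 1) := by
  simp [EuclideanSpace.fderiv_apply_eq_sum_gradient F x (EuclideanSpace.single i 1)]

theorem EuclideanSpace.sum_sq_ne_zero {n : ℕ} {x : EuclideanSpace ℝ (Fin n)} (hx : x ≠ 0) :
    ∑ j, x j ^ 2 ≠ 0 := by
  rw [← EuclideanSpace.real_norm_sq_eq]
  exact pow_ne_zero 2 (norm_ne_zero_iff.mpr hx)

/-- The derivative of the normalized squares `c_i² / ∑_j c_j²` along a curve `c`. -/
theorem HasDerivAt.sq_div_sum_sq {n : ℕ} {c : ℝ → EuclideanSpace ℝ (Fin n)} {v : Fin n → ℝ}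
    {t : ℝ} (hc : ∀ j, HasDerivAt (fun s => c s j) (v j) t) (h0 : c t ≠ 0) (i : Fin n) :
    HasDerivAt (fun s => c s i ^ 2 / ∑ j, c s j ^ 2)
      (2 * c t i * v i / (∑ j, c t j ^ 2) -
        c t i ^ 2 * (2 * ∑ j, c t j * v j) / (∑ j, c t j ^ 2) ^ 2) t := by
  have hS := EuclideanSpace.sum_sq_ne_zero h0
  have hsq : ∀ j, HasDerivAt (fun s => c s j ^ 2) (2 * (c t j * v j)) t := fun j => by
    simpa [mul_assoc] using (hc j).fun_pow 2
  have hsum : HasDerivAt (fun s => ∑ j, c s j ^ 2) (2 * ∑ j, c t j * v j) t := by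
    rw [Finset.mul_sum]
    exact HasDerivAt.fun_sum fun j _ => hsq j
  refine ((hsq i).fun_div hsum hS).congr_deriv ?_
  field_simp

/-- The gradient of `f ∘ W` for the parametrization `W` of the simplex by normalized squares. -/
theorem gradient_comp_sq_div_sum_sq {n : ℕ}
    {f : EuclideanSpace ℝ (Fin n) → ℝ}
    {W : EuclideanSpace ℝ (Fin n) → EuclideanSpace ℝ (Fin n)}
    (hW : ∀ (x : EuclideanSpace ℝ (Fin n)) (i : Fin n), W x i = x i ^ 2 / ∑ j, x j ^ 2)
    {x : EuclideanSpace ℝ (Fin n)} (hf : DifferentiableAt ℝ f (W x)) (hx : x ≠ 0) (i : Fin n) :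
    gradient (f ∘ W) x i = 2 * x i / (∑ j, x j ^ 2) *
      (gradient f (W x) i - ∑ j, W x j * gradient f (W x) j) := by
  have hS := EuclideanSpace.sum_sq_ne_zero hx
  have hWd : DifferentiableAt ℝ W x := by
    rw [differentiableAt_euclidean]
    intro k
    simp only [hW]
    fun_prop (disch := exact hS)
  set e : EuclideanSpace ℝ (Fin n) := EuclideanSpace.single i 1 with he
  have hline : ∀ j, HasDerivAt (fun s : ℝ => (x + s • e) j) (e j) 0 := fun j => by
    simpa using ((hasDerivAt_id (0 : ℝ)).mul_const (e j)).const_add (x j)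
  have hpartial : ∀ k, fderiv ℝ W x e k =
      2 * x k * e k / (∑ j, x j ^ 2) - x k ^ 2 * (2 * x i) / (∑ j, x j ^ 2) ^ 2 := fun k => by
    have h1 : HasDerivAt (fun s : ℝ => W (x + s • e)) (fderiv ℝ W x e) 0 :=
      hWd.hasFDerivAt.hasLineDerivAt e
    have h2 := HasDerivAt.sq_div_sum_sq hline (by simpa using hx) k
    simp only [← hW] at h2
    have h3 := ((EuclideanSpace.proj (𝕜 := ℝ) k).hasFDerivAt.comp_hasDerivAt 0 h1).unique h2
    simpa [he] using h3
  rw [EuclideanSpace.gradient_apply, fderiv_comp x hf hWd, ContinuousLinearMap.comp_apply,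
    EuclideanSpace.fderiv_apply_eq_sum_gradient, ← he]
  simp only [hpartial, sub_mul, Finset.sum_sub_distrib, mul_sub, hW, Finset.mul_sum]
  congr 1
  · rw [Finset.sum_eq_single i]
    · simp [he]
    · intro k _ hk
      simp [he, hk]
    · simp
  · refine Finset.sum_congr rfl fun k _ => ?_
    field_simp

/-- Latent-variable derivation of the Cauchy-Simplex flow: if `w_i = ψ_i²/∑_j ψ_j²` and
`ψ` performs gradient descent `dψ/dt = -α ∇_ψ (f ∘ w)` with `ψ(t) ≠ 0`, then `w(ψ(t))`
satisfies `dw_i/dt = -β(t) w_i (∇_i f(w) - w·∇f(w))` with `β(t) = 4α/‖ψ(t)‖²`. -/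
theorem latent_gradient_descent_induces_cauchy_simplex_flow {n : ℕ}
    (f : EuclideanSpace ℝ (Fin n) → ℝ) (hf : Differentiable ℝ f)
    (α : ℝ) (hα : 0 < α)
    (W : EuclideanSpace ℝ (Fin n) → EuclideanSpace ℝ (Fin n))
    (hW : ∀ (ψ : EuclideanSpace ℝ (Fin n)) (i : Fin n), W ψ i = ψ i ^ 2 / ∑ j, ψ j ^ 2)
    (ψ : ℝ → EuclideanSpace ℝ (Fin n)) (hψ0 : ∀ t, ψ t ≠ 0)
    (hode : ∀ (t : ℝ) (i : Fin n),
      HasDerivAt (fun s => ψ s i) (-α * gradient (f ∘ W) (ψ t) i) t) :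
    ∀ (t : ℝ) (i : Fin n),
      HasDerivAt (fun s => W (ψ s) i)
        (-(4 * α / ‖ψ t‖ ^ 2) * (W (ψ t) i *
          (gradient f (W (ψ t)) i - ∑ j, W (ψ t) j * gradient f (W (ψ t)) j))) t := by
  intro t i
  have hS := EuclideanSpace.sum_sq_ne_zero (hψ0 t)
  have hWsum : ∑ j, W (ψ t) j = 1 := by
    simp only [hW, ← Finset.sum_div]
    exact div_self hS
  have hgrad := gradient_comp_sq_div_sum_sq hW (hf _) (hψ0 t)
  have horth : ∑ j, ψ t j * (-α * gradient (f ∘ W) (ψ t) j) = 0 := by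
    set m := ∑ j, W (ψ t) j * gradient f (W (ψ t)) j with hm
    have hterm : ∀ j, ψ t j * (-α * gradient (f ∘ W) (ψ t) j) =
        -2 * α * (W (ψ t) j * gradient f (W (ψ t)) j - W (ψ t) j * m) := fun j => by
      rw [hgrad, hW (ψ t) j]
      ring
    simp only [hterm]
    rw [← Finset.mul_sum, Finset.sum_sub_distrib, ← Finset.sum_mul, hWsum, ← hm]
    ring
  have h := HasDerivAt.sq_div_sum_sq (hode t) (hψ0 t) i
  simp only [← hW] at h
  refine h.congr_deriv ?_
  rw [horth, hgrad, EuclideanSpace.real_norm_sq_eq, hW (ψ t) i]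
  ring
end
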